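/- Let q = 2^m, 1 < t < q, N = (q+1)(t−1) (so N+1 = qt−q+t), F = 𝔽_q, K = 𝔽_{q²}. If C is an extended cyclic code over F with parameters [qt−q+t, 3, qt−q], then N divides q²−1 and there exist a generator γ of the cyclic group S' = {x ∈ K : x^N = 1} and an F-basis {1, ξ} of K such that, writing γ^{−i} = x_i + y_i·ξ with x_i, y_i ∈ F, the code C equals the row space of the 3×(N+1) matrix whose columns are (x_i, y_i, 1) for i = 0, …, N−1 followed by (0, 0, 1); the corresponding point set {x ∈ K : x^N = 1} ∪ {0} ⊆ K is a cyclic Denniston maximal arc of AG(2, q), i.e. a set of qt−q+t affine points meeting every affine line in exactly 0 or t points. -/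

import Mathlib

/-- A linear code `C ⊆ F^n` is cyclic if the cyclic shift
`(c₀, …, c_{n−1}) ↦ (c_{n−1}, c₀, …, c_{n−2})` maps `C` into itself. -/
def IsCyclicCode {F : Type*} [Field F] {n : ℕ} (C : Submodule F (Fin n → F)) : Prop :=
  ∀ c ∈ C, (fun i : Fin n => c ⟨((i : ℕ) + n - 1) % n, Nat.mod_lt _ i.pos⟩) ∈ C

/-- The linear map sending a word to the word extended by the sum of its coordinates. -/
def extendLM (F : Type*) [Field F] (n : ℕ) : (Fin n → F) →ₗ[F] (Fin (n + 1) → F) where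
  toFun c := Fin.snoc c (∑ i, c i)
  map_add' c d := by
    funext i
    refine Fin.lastCases ?_ (fun j => ?_) i
    · simp [Finset.sum_add_distrib]
    · simp
  map_smul' a c := by
    funext i
    refine Fin.lastCases ?_ (fun j => ?_) i
    · simp [Finset.mul_sum]
    · simp

/-- The extended code of a code of length `n`. -/
def extendCode {F : Type*} [Field F] {n : ℕ} (C : Submodule F (Fin n → F)) :
    Submodule F (Fin (n + 1) → F) :=
  C.map (extendLM F n)

/-- The dual code `C⊥ = {x : Σ_i x_i c_i = 0 for all c ∈ C}`. -/
def dualCode {F : Type*} [Field F] {n : ℕ} (C : Submodule F (Fin n → F)) :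
    Submodule F (Fin n → F) where
  carrier := {x | ∀ c ∈ C, ∑ i, x i * c i = 0}
  add_mem' := by
    intro a b ha hb c hc
    simpa [add_mul, Finset.sum_add_distrib] using by rw [ha c hc, hb c hc, add_zero]
  zero_mem' := by intro c hc; simp
  smul_mem' := by
    intro a x hx c hc
    simp only [Pi.smul_apply, smul_eq_mul, mul_assoc, ← Finset.mul_sum, hx c hc, mul_zero]


open Polynomial in
/-- An endomorphism of a plane is annihilated by a monic quadratic, and it has an eigenvector
as soon as this quadratic has a root. -/
theorem exists_quadratic_annihilating {F V : Type*} [Field F] [AddCommGroup V] [Module F V]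
    (hV : Module.finrank F V = 2) (T : V →ₗ[F] V) :
    ∃ a b : F, (∀ v, T (T v) + a • T v + b • v = 0) ∧
      ∀ r : F, r ^ 2 + a * r + b = 0 → ∃ v, v ≠ 0 ∧ ∃ l : F, T v = l • v := by
  have : Module.Finite F V := Module.finite_of_finrank_pos (by omega)
  have : Nontrivial V := Module.nontrivial_of_finrank_pos (R := F) (by omega)
  obtain ⟨a, b, hab⟩ := isMonicOfDegree_two_iff.mp
    (⟨by rw [T.charpoly_natDegree, hV], T.charpoly_monic⟩ : IsMonicOfDegree T.charpoly 2)
  have hT : ∀ v, T (T v) + a • T v + b • v = 0 := by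
    intro v
    have h := LinearMap.congr_fun T.aeval_self_charpoly v
    rw [hab] at h
    simpa [pow_two, Algebra.smul_def] using h
  refine ⟨a, b, hT, fun r hr => ?_⟩
  by_cases h : ∃ v, T v + (a + r) • v ≠ 0
  · obtain ⟨v, hv⟩ := h
    refine ⟨_, hv, r, ?_⟩
    have h1 := hT v
    have h2 : b = -(r ^ 2 + a * r) := by linear_combination hr
    rw [← sub_eq_zero, ← h1, h2, map_add, map_smul]
    module
  · push Not at h
    obtain ⟨v, hv⟩ := exists_ne (0 : V)
    exact ⟨v, hv, -(a + r), by rw [neg_smul]; exact eq_neg_of_add_eq_zero_left (h v)⟩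

open Polynomial in
/-- A monic quadratic over a finite field has a root in any quadratic extension. -/
theorem exists_root_of_finrank_eq_two {F K : Type*} [Field F] [Field K] [Finite K]
    [Algebra F K] (hFK : Module.finrank F K = 2) (a b : F)
    (hab : ∀ r : F, r ^ 2 + a * r + b ≠ 0) :
    ∃ z : K, z ^ 2 + a • z + b • (1 : K) = 0 := by
  have hd := isMonicOfDegree_add_add_two a b
  set f : F[X] := X ^ 2 + C a * X + C b
  have hirr : Irreducible f := by
    refine irreducible_of_degree_le_three_of_not_isRoot (by simp [hd.natDegree_eq]) fun r hr => ?_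
    exact hab r (by simpa [f] using hr)
  have : Fact (Irreducible f) := ⟨hirr⟩
  have hrank : Module.finrank F (AdjoinRoot f) = 2 := by
    rw [(AdjoinRoot.powerBasis hirr.ne_zero).finrank, AdjoinRoot.powerBasis_dim, hd.natDegree_eq]
  obtain ⟨g⟩ := FiniteField.nonempty_algHom_of_finrank_dvd (F := F) (K := AdjoinRoot f) (L := K)
    (by rw [hrank, hFK])
  refine ⟨g (AdjoinRoot.root f), ?_⟩
  have h : aeval (AdjoinRoot.root f) f = 0 := by simp [AdjoinRoot.aeval_eq]
  have h' := congrArg g h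
  rw [← aeval_algHom_apply, map_zero] at h'
  generalize g (AdjoinRoot.root f) = z at h' ⊢
  simpa [f, Algebra.smul_def] using h'

open Finset in
/-- A linear functional on a finite vector space of dimension `n + 1` vanishes on at least `q ^ n`
vectors. -/
theorem card_le_card_filter_apply_eq_zero {F V : Type*} [Field F] [Fintype F] [AddCommGroup V]
    [Module F V] [Fintype V] [DecidableEq F] {n : ℕ} (hV : Module.finrank F V = n + 1)
    (f : Module.Dual F V) :
    Fintype.card F ^ n ≤ #{v | f v = 0} := by
  have h1 : Fintype.card F ^ Module.finrank F (LinearMap.ker f) = #{v | f v = 0} := by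
    rw [← Nat.card_eq_fintype_card, ← Module.natCard_eq_pow_finrank, ← Fintype.card_subtype,
      ← Nat.card_eq_fintype_card]
    exact Nat.card_congr (Equiv.subtypeEquivRight fun v => LinearMap.mem_ker)
  rw [← h1]
  refine Nat.pow_le_pow_right Fintype.card_pos ?_
  by_cases hf : f = 0
  · subst hf; rw [LinearMap.ker_zero, finrank_top, hV]; omega
  · have := Module.Dual.finrank_ker_add_one_of_ne_zero hf
    omega

open Finset in
/-- If each nonzero vector of a plane is annihilated by at most `t` members of a family of
`(q + 1) * (t - 1) + 1` functionals one of which is zero, then each nonzero vector is annihilated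
by exactly `t` members, and no other member of the family is zero. -/
theorem card_filter_eq_of_card_filter_le {F V ι : Type*} [Field F] [Fintype F] [DecidableEq F]
    [AddCommGroup V] [Module F V] [Fintype ι] (hV : Module.finrank F V = 2) {t : ℕ} (ht : 1 ≤ t)
    (e : ι → Module.Dual F V)
    (hcard : Fintype.card ι = (Fintype.card F + 1) * (t - 1) + 1)
    (hle : ∀ v, v ≠ 0 → #{i | e i v = 0} ≤ t) {j : ι} (hj : e j = 0) :
    (∀ i, i ≠ j → e i ≠ 0) ∧ ∀ v, v ≠ 0 → #{i | e i v = 0} = t := by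
  classical
  have : Module.Finite F V := Module.finite_of_finrank_pos (by omega)
  have : Finite V := Module.finite_of_finite F
  let _ : Fintype V := Fintype.ofFinite V
  set q := Fintype.card F with hq
  have hq1 : 1 < q := Fintype.one_lt_card
  have hVc : Fintype.card V = q ^ 2 := by rw [Module.card_eq_pow_finrank (K := F), hV]
  let S : Finset V := univ.erase 0
  have hS : #S = q ^ 2 - 1 := by simp [S, hVc]
  let n : ι → ℕ := fun i => #{v ∈ S | e i v = 0}
  have hn : ∀ i, q - 1 ≤ n i := by
    intro i
    have h1 := card_le_card_filter_apply_eq_zero (n := 1) hV (e i)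
    have h2 : n i = #(({v | e i v = 0} : Finset V).erase 0) := by
      refine congrArg card ?_
      ext v
      simp [S]
    rw [h2, card_erase_of_mem (by simp)]
    rw [pow_one] at h1
    omega
  have hn0 : ∀ i, e i = 0 → n i = q ^ 2 - 1 := by
    intro i hi
    simp [n, hi, hS]
  have hsum : ∑ v ∈ S, #{i | e i v = 0} = ∑ i, n i :=
    sum_card_bipartiteAbove_eq_sum_card_bipartiteBelow (s := S) (t := univ)
      (r := fun v i => e i v = 0)
  have hupper : ∑ v ∈ S, #{i | e i v = 0} ≤ ∑ v ∈ S, t :=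
    sum_le_sum fun v hv => hle v (by simpa [S] using hv)
  have hlower : ∑ i ∈ univ.erase j, (q - 1) ≤ ∑ i ∈ univ.erase j, n i :=
    sum_le_sum fun i _ => hn i
  have hsplit : n j + ∑ i ∈ univ.erase j, n i = ∑ i, n i := add_sum_erase _ _ (mem_univ j)
  have hval : (q ^ 2 - 1) + ∑ i ∈ univ.erase j, (q - 1) = ∑ v ∈ S, t := by
    rw [sum_const, sum_const, card_erase_of_mem (mem_univ j), card_univ, hcard, hS,
      Nat.add_sub_cancel, smul_eq_mul, smul_eq_mul]
    obtain ⟨s, rfl⟩ := Nat.exists_eq_add_of_le ht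
    obtain ⟨r, hr⟩ := Nat.exists_eq_add_of_le hq1.le
    have h2 : q ^ 2 - 1 = (r + 2) * r := by
      rw [hr]; exact Nat.sub_eq_of_eq_add (by ring)
    rw [h2, hr, Nat.add_sub_cancel_left, Nat.add_sub_cancel_left]
    ring
  rw [hn0 j hj] at hsplit
  constructor
  · intro i hij hi
    have h1 : ∑ i ∈ univ.erase j, n i = ∑ i ∈ univ.erase j, (q - 1) := by omega
    have h2 := (sum_eq_sum_iff_of_le fun i _ => hn i).mp h1.symm i (by simp [hij])
    rw [hn0 i hi] at h2
    have : q < q ^ 2 := by nlinarith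
    omega
  · intro w hw
    have h1 : ∑ v ∈ S, #{i | e i v = 0} = ∑ v ∈ S, t := by omega
    exact (sum_eq_sum_iff_of_le fun v hv => hle v (by simpa [S] using hv)).mp h1 w
      (by simpa [S] using hw)

open Finset in
/-- The dual form of the fact that a set of `(q + 1) * (t - 1) + 1` points of a projective plane of
order `q` with at most `t` points on each line is a maximal arc. -/
theorem maximal_arc_of_card_filter_le {F V ι : Type*} [Field F] [Fintype F] [DecidableEq F]
    [AddCommGroup V] [Module F V] [Fintype ι] (hV : Module.finrank F V = 3) {t : ℕ} (ht : 1 ≤ t)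
    (e : ι → Module.Dual F V)
    (hcard : Fintype.card ι = (Fintype.card F + 1) * (t - 1) + 1)
    (hle : ∀ v, v ≠ 0 → #{i | e i v = 0} ≤ t) {j : ι} (hj : e j ≠ 0) :
    (∀ i, i ≠ j → ∃ v, e j v = 0 ∧ e i v ≠ 0) ∧
      ∀ v, v ≠ 0 → e j v = 0 → #{i | e i v = 0} = t := by
  have : Module.Finite F V := Module.finite_of_finrank_pos (by omega)
  have hD := Module.Dual.finrank_ker_add_one_of_ne_zero hj
  obtain ⟨h1, h2⟩ := card_filter_eq_of_card_filter_le (V := LinearMap.ker (e j)) (by omega) ht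
    (fun i => (e i).comp (LinearMap.ker (e j)).subtype) hcard
    (fun v hv => hle v (by simpa using hv)) (j := j) (by ext v; exact v.2)
  constructor
  · intro i hij
    by_contra! h
    exact h1 i hij (by ext v; exact h v v.2)
  · intro v hv hjv
    exact h2 ⟨v, hjv⟩ fun h => hv (congrArg Subtype.val h)

/-- A cyclic code is closed under all rotations. -/
theorem IsCyclicCode.rotate_mem {F : Type*} [Field F] {n : ℕ} [NeZero n]
    {C : Submodule F (Fin n → F)} (hC : IsCyclicCode C) {c : Fin n → F} (hc : c ∈ C) (s : ℕ) :
    (fun i : Fin n => c (Fin.ofNat n (i + s))) ∈ C := by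
  have hn : 1 ≤ n := NeZero.one_le
  have key : ∀ k : ℕ, (fun i : Fin n => c (Fin.ofNat n (i + k * (n - 1)))) ∈ C := by
    intro k
    induction k with
    | zero => simpa using hc
    | succ k ih =>
      convert hC _ ih using 1
      ext i
      congr 1
      ext
      simp only [Fin.val_ofNat, Nat.mod_add_mod]
      congr 1
      rw [Nat.add_sub_assoc hn]
      ring
  convert key (s * (n - 1)) using 1
  ext i
  congr 1
  ext
  simp only [Fin.val_ofNat]
  obtain ⟨r, rfl⟩ := Nat.exists_eq_add_of_le hn
  rcases r with _ | r
  · simp [Nat.mod_one]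
  · rw [show (i : ℕ) + s * (1 + (r + 1) - 1) * (1 + (r + 1) - 1) = i + s + (1 + (r + 1)) * (s * r) by
      rw [Nat.add_sub_cancel_left]; ring, Nat.add_mul_mod_self_left]

/-- A two-dimensional rotation-invariant code over `F` in which every word has a zero consists of
the coordinate words of the powers of some element `β` of the quadratic extension of `F`. -/
theorem exists_powers_of_rotation_invariant {F K : Type*} [Field F] [Field K] [Finite K]
    [Algebra F K] (hFK : Module.finrank F K = 2) {n : ℕ} [NeZero n] (D : Submodule F (Fin n → F))
    (hD : Module.finrank F D = 2)
    (hrot : ∀ c ∈ D, (fun i : Fin n => c (Fin.ofNat n (i + 1))) ∈ D)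
    (hzero : ∀ c ∈ D, ∃ i, c i = 0) :
    ∃ (β : K) (x y : ℕ → F), (∀ z : K, ∃! p : F × F, z = algebraMap F K p.1 + p.2 • β) ∧
      (∀ i, algebraMap F K (x i) + y i • β = β ^ i) ∧ β ^ n = 1 ∧
      (fun i : Fin n => x i) ∈ D ∧ (fun i : Fin n => y i) ∈ D ∧
      ∀ c ∈ D, ∃ r s : F, ∀ i : Fin n, c i = r * x i + s * y i := by
  have : Module.Finite F D := Module.finite_of_finrank_pos (by omega)
  have : Module.Finite F K := Module.finite_of_finrank_pos (by omega)
  have : Nontrivial D := Module.nontrivial_of_finrank_pos (R := F) (by omega)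
  let T : D →ₗ[F] D :=
    (LinearMap.funLeft F F fun i : Fin n => Fin.ofNat n (i + 1)).restrict hrot
  have hT : ∀ (c : D) (i : ℕ), (T c).1 (Fin.ofNat n i) = c.1 (Fin.ofNat n (i + 1)) := by
    intro c i
    change c.1 (Fin.ofNat n _) = _
    refine congrArg c.1 ?_
    ext
    simp
  have hofNat : ∀ i : Fin n, Fin.ofNat n i = i := fun i => by ext; simp
  obtain ⟨a, b, hab, hroot⟩ := exists_quadratic_annihilating hD T
  have hrec : ∀ (c : D) (i : ℕ), c.1 (Fin.ofNat n (i + 2)) =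
      -a * c.1 (Fin.ofNat n (i + 1)) - b * c.1 (Fin.ofNat n i) := by
    intro c i
    have h := congrFun (congrArg Subtype.val (hab c)) (Fin.ofNat n i)
    simp only [Submodule.coe_add, Submodule.coe_smul, Pi.add_apply, Pi.smul_apply, smul_eq_mul,
      hT, ZeroMemClass.coe_zero, Pi.zero_apply, add_assoc] at h
    linear_combination h
  have hnoroot : ∀ r : F, r ^ 2 + a * r + b ≠ 0 := by
    intro r hr
    obtain ⟨c, hc, l, hl⟩ := hroot r hr
    obtain ⟨i, hi⟩ := hzero c c.2
    have hk : ∀ k : ℕ, c.1 (Fin.ofNat n (i + k)) = 0 := by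
      intro k
      induction k with
      | zero => simpa [hofNat] using hi
      | succ k ih =>
        rw [← add_assoc, ← hT, hl, Submodule.coe_smul, Pi.smul_apply, ih, smul_zero]
    apply hc
    ext j
    have := hk (n - i + j)
    rw [← add_assoc, Nat.add_sub_cancel' i.2.le] at this
    rw [← hofNat j, show Fin.ofNat n j = Fin.ofNat n (n + j) by
      ext; simp [Nat.mod_eq_of_lt j.2], this]
    rfl
  obtain ⟨β, hβ⟩ := exists_root_of_finrank_eq_two hFK a b hnoroot
  let f : F × F →ₗ[F] K := (Algebra.linearMap F K).coprod (LinearMap.toSpanSingleton F K β)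
  have hf : ∀ p, f p = algebraMap F K p.1 + p.2 • β := fun p => by simp [f]
  have hfinj : Function.Injective f := by
    rw [← LinearMap.ker_eq_bot, LinearMap.ker_eq_bot']
    rintro ⟨r, s⟩ h
    rw [hf] at h
    simp only [Algebra.smul_def] at h hβ
    by_cases hs : s = 0
    · subst hs
      simpa using h
    · exfalso
      apply hnoroot (-r / s)
      apply (algebraMap F K).injective
      have hs' : algebraMap F K s ≠ 0 := by simpa using hs
      have hβ' : β = algebraMap F K (-r / s) := by
        rw [map_div₀, map_neg]
        field_simp
        linear_combination h
      rw [map_add, map_add, map_mul, map_pow, ← hβ', map_zero]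
      linear_combination hβ
  have hfbij : Function.Bijective f :=
    ⟨hfinj, (LinearMap.injective_iff_surjective_of_finrank_eq_finrank
      (by simp [hFK])).mp hfinj⟩
  have hcoord : ∀ z : K, ∃! p : F × F, z = algebraMap F K p.1 + p.2 • β := by
    intro z
    obtain ⟨p, hp, hu⟩ := hfbij.existsUnique z
    exact ⟨p, hp.symm.trans (hf p), fun p' hp' => hu p' ((hf p').trans hp'.symm)⟩
  choose p hp _ using fun i : ℕ => hcoord (β ^ i)
  have hfp : ∀ i, f (p i) = β ^ i := fun i => by rw [hf, ← hp]
  have hp0 : p 0 = (1, 0) := hfinj (by rw [hfp, hf]; simp)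
  have hp1 : p 1 = (0, 1) := hfinj (by rw [hfp, hf]; simp)
  have hprec : ∀ i, p (i + 2) = -a • p (i + 1) - b • p i := by
    intro i
    apply hfinj
    rw [map_sub, map_smul, map_smul, hfp, hfp, hfp]
    simp only [Algebra.smul_def, map_neg] at hβ ⊢
    linear_combination β ^ i * hβ
  have hseq : ∀ (c : D) (i : ℕ), c.1 (Fin.ofNat n i) =
      c.1 (Fin.ofNat n 0) * (p i).1 + c.1 (Fin.ofNat n 1) * (p i).2 := by
    intro c i
    induction i using Nat.twoStepInduction with
    | zero => simp [hp0]
    | one => simp [hp1]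
    | more i h1 h2 =>
      rw [hrec, h1, h2, hprec]
      simp
      ring
  let g : D →ₗ[F] F × F :=
    ((LinearMap.proj (Fin.ofNat n 0)).prod (LinearMap.proj (Fin.ofNat n 1))).comp D.subtype
  have hginj : Function.Injective g := by
    rw [← LinearMap.ker_eq_bot, LinearMap.ker_eq_bot']
    intro c hc
    have h0 : c.1 (Fin.ofNat n 0) = 0 := congrArg Prod.fst hc
    have h1 : c.1 (Fin.ofNat n 1) = 0 := congrArg Prod.snd hc
    ext j
    rw [← hofNat j, hseq, h0, h1]
    simp
  have hgsurj : Function.Surjective g :=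
    (LinearMap.injective_iff_surjective_of_finrank_eq_finrank (by simp [hD])).mp hginj
  obtain ⟨X, hX⟩ := hgsurj (1, 0)
  obtain ⟨Y, hY⟩ := hgsurj (0, 1)
  have hX' : ∀ i : ℕ, X.1 (Fin.ofNat n i) = (p i).1 := by
    intro i
    rw [hseq, show X.1 (Fin.ofNat n 0) = 1 from congrArg Prod.fst hX,
      show X.1 (Fin.ofNat n 1) = 0 from congrArg Prod.snd hX]
    simp
  have hY' : ∀ i : ℕ, Y.1 (Fin.ofNat n i) = (p i).2 := by
    intro i
    rw [hseq, show Y.1 (Fin.ofNat n 0) = 0 from congrArg Prod.fst hY,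
      show Y.1 (Fin.ofNat n 1) = 1 from congrArg Prod.snd hY]
    simp
  have hn0 : Fin.ofNat n n = Fin.ofNat n 0 := by ext; simp
  refine ⟨β, fun i => (p i).1, fun i => (p i).2, hcoord, fun i => (hp i).symm, ?_, ?_, ?_, ?_⟩
  · rw [← pow_zero β, ← hfp, ← hfp]
    congr 1
    ext
    · rw [← hX', ← hX', hn0]
    · rw [← hY', ← hY', hn0]
  · convert X.2 using 1
    ext i
    exact (hX' i).symm.trans (congrArg X.1 (hofNat i))
  · convert Y.2 using 1
    ext i
    exact (hY' i).symm.trans (congrArg Y.1 (hofNat i))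
  · intro c hc
    exact ⟨_, _, fun i => by rw [← hseq ⟨c, hc⟩ i, hofNat]⟩

theorem Fin.ofNat_val_add_val {n : ℕ} [NeZero n] (i j : Fin n) :
    Fin.ofNat n (i + j) = i + j := by
  ext
  simp [Fin.val_add]

/-- A cyclic code with a word of nonzero coordinate sum contains the all-one word. -/
theorem IsCyclicCode.one_mem {F : Type*} [Field F] {n : ℕ} [NeZero n]
    {C : Submodule F (Fin n → F)} (hC : IsCyclicCode C) {c : Fin n → F} (hc : c ∈ C)
    (hsum : ∑ i, c i ≠ 0) : (fun _ : Fin n => (1 : F)) ∈ C := by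
  have h : ∑ s : Fin n, (fun i : Fin n => c (Fin.ofNat n (i + s))) ∈ C :=
    Submodule.sum_mem _ fun s _ => hC.rotate_mem hc s
  convert C.smul_mem (∑ i, c i)⁻¹ h using 1
  ext i
  simp only [Pi.smul_apply, Finset.sum_apply, smul_eq_mul, Fin.ofNat_val_add_val]
  rw [show ∑ s, c (i + s) = ∑ s, c s from Equiv.sum_comp (Equiv.addLeft i) c,
    inv_mul_cancel₀ hsum]

theorem sum_rotate {F : Type*} [Field F] {n : ℕ} [NeZero n] (c : Fin n → F) :
    ∑ i : Fin n, c (Fin.ofNat n (i + 1)) = ∑ i, c i := by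
  rw [← Equiv.sum_comp (Equiv.addRight (Fin.ofNat n 1)) c]
  refine Finset.sum_congr rfl fun i _ => congrArg c ?_
  ext
  simp [Fin.val_add]

theorem extendLM_injective (F : Type*) [Field F] (n : ℕ) :
    Function.Injective (extendLM F n) := by
  intro c d h
  ext i
  have := congrFun h (Fin.castSucc i)
  simpa [extendLM] using this

theorem mem_extendCode_iff {F : Type*} [Field F] {n : ℕ} {C : Submodule F (Fin n → F)}
    {c : Fin (n + 1) → F} :
    c ∈ extendCode C ↔ ∃ d ∈ C, (Fin.snoc d (∑ i, d i) : Fin (n + 1) → F) = c :=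
  Submodule.mem_map

theorem finrank_extendCode {F : Type*} [Field F] {n : ℕ} (C : Submodule F (Fin n → F)) :
    Module.finrank F (extendCode C) = Module.finrank F C :=
  (Submodule.equivMapOfInjective _ (extendLM_injective F n) C).finrank_eq.symm

/-- In coordinates with respect to a basis `1, β`, a line is the zero set of an affine
functional. -/
theorem exists_eq_add_smul_iff {F K : Type*} [Field F] [Field K] [Algebra F K] {β : K}
    (hβ : ∀ z : K, ∃! p : F × F, z = algebraMap F K p.1 + p.2 • β) {a b z : K}
    {a₁ a₂ b₁ b₂ z₁ z₂ : F} (ha : a = algebraMap F K a₁ + a₂ • β)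
    (hb : b = algebraMap F K b₁ + b₂ • β) (hz : z = algebraMap F K z₁ + z₂ • β) (hb0 : b ≠ 0) :
    (∃ c : F, z = a + c • b) ↔ b₂ * z₁ - b₁ * z₂ - (b₂ * a₁ - b₁ * a₂) = 0 := by
  constructor
  · rintro ⟨c, hc⟩
    have h := (hβ z).unique (y₁ := (z₁, z₂)) (y₂ := (a₁ + c * b₁, a₂ + c * b₂)) hz (by
      rw [hc, ha, hb]
      simp only [Algebra.smul_def, map_add, map_mul]
      ring)
    obtain ⟨rfl, rfl⟩ := Prod.mk.inj h
    ring
  · intro h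
    have key : ∀ c, z₁ = a₁ + c * b₁ → z₂ = a₂ + c * b₂ → z = a + c • b := by
      rintro c rfl rfl
      rw [hz, ha, hb]
      simp only [Algebra.smul_def, map_add, map_mul]
      ring
    by_cases h1 : b₁ = 0
    · have h2 : b₂ ≠ 0 := by
        rintro rfl
        exact hb0 (by rw [hb, h1]; simp)
      refine ⟨(z₂ - a₂) / b₂, key _ ?_ ?_⟩
      · field_simp
        linear_combination h
      · field_simp
        ring
    · refine ⟨(z₁ - a₁) / b₁, key _ ?_ ?_⟩
      · field_simp
        ring
      · field_simp
        linear_combination -h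

open Finset in
/-- In an extended cyclic code with the parameters of a maximal arc, all coordinates are distinct
and each nonzero word with a zero has exactly `t` zeros. -/
theorem card_zeros_of_extendCode {F : Type*} [Field F] [Fintype F] [DecidableEq F] {n t : ℕ}
    [NeZero n] (ht : 1 ≤ t) (hn : n = (Fintype.card F + 1) * (t - 1))
    {C : Submodule F (Fin n → F)} (hC : IsCyclicCode C)
    (hdim : Module.finrank F (extendCode C) = 3)
    (hle : ∀ c ∈ extendCode C, c ≠ 0 → #{i | c i = 0} ≤ t) :
    (∀ i j, i ≠ j → ∃ c ∈ extendCode C, c j = 0 ∧ c i ≠ 0) ∧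
      ∀ c ∈ extendCode C, c ≠ 0 → ∀ i, c i = 0 → #{i | c i = 0} = t := by
  let e : Fin (n + 1) → Module.Dual F (extendCode C) := fun i =>
    (LinearMap.proj i).comp (extendCode C).subtype
  have arc := fun j hj => maximal_arc_of_card_filter_le hdim ht e (by rw [Fintype.card_fin, hn])
    (fun v hv => hle v v.2 (by simpa using hv)) (j := j) hj
  have h0 : e (Fin.castSucc 0) ≠ 0 := by
    intro h
    have hC0 : C = ⊥ := by
      rw [eq_bot_iff]
      intro c hc
      rw [Submodule.mem_bot]
      ext i
      have h1 := LinearMap.congr_fun h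
        ⟨_, mem_extendCode_iff.mpr ⟨_, hC.rotate_mem hc i, rfl⟩⟩
      simpa [e, -Fin.castSucc_zero, -Fin.castSucc_zero'] using h1
    rw [finrank_extendCode, hC0, finrank_bot] at hdim
    omega
  have hne : ∀ j, e j ≠ 0 := by
    intro j
    by_cases hj : j = Fin.castSucc 0
    · rwa [hj]
    · obtain ⟨v, -, hv⟩ := (arc _ h0).1 j hj
      exact fun h => hv (by rw [h]; rfl)
  constructor
  · intro i j hij
    obtain ⟨v, hv⟩ := (arc j (hne j)).1 i hij
    exact ⟨v, v.2, hv⟩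
  · intro c hc hc0 j hj
    exact (arc j (hne j)).2 ⟨c, hc⟩ (by simpa using hc0) hj

/-- **Theorem (extended cyclic `[qt−q+t, 3, qt−q]` codes come from cyclic Denniston
maximal arcs).**  Let `q = 2^m`, `1 < t < q`, `N = (q+1)(t−1)` (so `N+1 = qt−q+t`),
`F = 𝔽_q ⊆ K = 𝔽_{q²}`.  If `C` is an extended cyclic code over `F` with parameters
`[qt−q+t, 3, qt−q]`, then `N ∣ q²−1` and there are a generator `γ` of the cyclic group
`S' = {x ∈ K : x^N = 1}` and an `F`-basis `{1, ξ}` of `K` such that, writing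
`γ^{−i} = x_i + y_i ξ`, the code `C` is the row space of the `3 × (N+1)` matrix with
columns `(x_i, y_i, 1)`, `0 ≤ i ≤ N−1`, followed by `(0, 0, 1)`; the point set
`{x ∈ K : x^N = 1} ∪ {0}` is a cyclic Denniston maximal arc of `AG(2,q) = K`: a set of
`qt−q+t` affine points meeting every affine line in exactly `0` or `t` points. -/
theorem extended_cyclic_code_gives_cyclic_denniston_arc
    (m q t N : ℕ) (hm : 1 ≤ m) (hq : q = 2 ^ m) (ht1 : 1 < t) (ht2 : t < q)
    (hN : N = (q + 1) * (t - 1))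
    (F K : Type*) [Field F] [Fintype F] [DecidableEq F] [Field K] [Fintype K] [Algebra F K]
    (hF : Fintype.card F = q) (hK : Fintype.card K = q ^ 2)
    (C : Submodule F (Fin (N + 1) → F))
    (hext : ∃ C' : Submodule F (Fin N → F), IsCyclicCode C' ∧ C = extendCode C')
    (hdim : Module.finrank F ↥C = 3)
    (hdist : (∀ c ∈ C, c ≠ 0 → q * t - q ≤ hammingNorm c) ∧
      ∃ c ∈ C, c ≠ 0 ∧ hammingNorm c = q * t - q) :
    N ∣ q ^ 2 - 1 ∧
    ∃ (γ ξ : K) (x y : Fin N → F),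
      orderOf γ = N ∧
      (∀ z : K, ∃! p : F × F, z = algebraMap F K p.1 + p.2 • ξ) ∧
      (∀ i : Fin N, algebraMap F K (x i) + y i • ξ = γ⁻¹ ^ (i : ℕ)) ∧
      C = Submodule.span F {Fin.snoc x 0, Fin.snoc y 0, fun _ => 1} ∧
      (Set.range fun i : Fin N => γ⁻¹ ^ (i : ℕ)) ∪ {0} = {z : K | z ^ N = 1} ∪ {0} ∧
      Set.ncard ({z : K | z ^ N = 1} ∪ {0}) = q * t - q + t ∧
      (∀ a b : K, b ≠ 0 →
        (({z : K | z ^ N = 1} ∪ {0}) ∩ {z : K | ∃ c : F, z = a + c • b}).ncard = 0 ∨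
        (({z : K | z ^ N = 1} ∪ {0}) ∩ {z : K | ∃ c : F, z = a + c • b}).ncard = t) := by
  classical
  obtain ⟨C', hcyc, rfl⟩ := hext
  have hN2 : 2 ≤ N := by
    rw [hN]
    exact Nat.mul_le_mul (by omega : 2 ≤ q + 1) (by omega : 1 ≤ t - 1)
  have : NeZero N := ⟨by omega⟩
  have hlen : N + 1 = q * t - q + t := by
    obtain ⟨s, rfl⟩ := Nat.exists_eq_add_of_lt ht1
    have h1 : q * (1 + s + 1) - q = q * (s + 1) := Nat.sub_eq_of_eq_add (by ring)
    have h2 : 1 + s + 1 - 1 = s + 1 := by omega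
    rw [hN, h1, h2]
    ring
  have hle : ∀ c ∈ extendCode C', c ≠ 0 → Finset.card {i | c i = 0} ≤ t := by
    intro c hc hc0
    have h1 := hdist.1 c hc hc0
    have h2 := Finset.card_filter_add_card_filter_not (s := Finset.univ) (fun i => c i = 0)
    rw [Finset.card_univ, Fintype.card_fin] at h2
    unfold hammingNorm at h1
    simp only [ne_eq] at h1
    omega
  obtain ⟨hsep, hzeros⟩ := card_zeros_of_extendCode ht1.le (by rw [hF, hN]) hcyc hdim hle
  have hfull : ∀ c : Fin N → F, (∀ i, c i ≠ 0) → ∑ i, c i = 0 → c ∉ C' := by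
    intro c hc hsum hmem
    have h := hzeros _ (mem_extendCode_iff.mpr ⟨c, hmem, rfl⟩)
      (fun h => hc 0 (by
        simpa [-Fin.castSucc_zero, -Fin.castSucc_zero'] using congrFun h (Fin.castSucc 0)))
      (Fin.last N) (by simpa using hsum)
    have h1 : ({i | (Fin.snoc c (∑ i, c i) : Fin (N + 1) → F) i = 0} : Finset (Fin (N + 1))) =
        {Fin.last N} := by
      ext i
      refine Fin.lastCases ?_ (fun j => ?_) i
      · simp [hsum]
      · simp [hc j, (Fin.castSucc_lt_last j).ne]
    rw [h1, Finset.card_singleton] at h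
    omega
  have hone : (fun _ : Fin N => (1 : F)) ∈ C' := by
    obtain ⟨c, hc, -, hc0⟩ := hsep (Fin.last N) 0 (Fin.last_pos' (n := N)).ne'
    obtain ⟨d, hd, rfl⟩ := mem_extendCode_iff.mp hc
    exact hcyc.one_mem hd (by simpa using hc0)
  have hchar : CharP F 2 := by
    have : Fact (Nat.Prime 2) := ⟨Nat.prime_two⟩
    exact charP_of_card_eq_prime_pow (hF.trans hq)
  have hNF : (N : F) = 1 := by
    rcases Nat.even_or_odd N with h | h
    · exact absurd hone (hfull _ (fun _ => one_ne_zero) (by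
        simpa using (CharP.cast_eq_zero_iff F 2 N).mpr h.two_dvd))
    · obtain ⟨k, hk⟩ := h
      rw [hk]
      push_cast
      rw [CharTwo.two_eq_zero]
      ring
  let φ : Module.Dual F (Fin N → F) := ∑ i, LinearMap.proj i
  have hφ : ∀ c, φ c = ∑ i, c i := fun c => by simp [φ]
  let D : Submodule F (Fin N → F) := (LinearMap.ker (φ.domRestrict C')).map C'.subtype
  have hD : ∀ c, c ∈ D ↔ c ∈ C' ∧ ∑ i, c i = 0 := by
    intro c
    simp [D, hφ, and_comm]
  have hDdim : Module.finrank F D = 2 := by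
    have h1 : φ.domRestrict C' ≠ 0 := by
      intro h
      have := LinearMap.congr_fun h ⟨_, hone⟩
      simp [hφ, hNF] at this
    have h2 := Module.Dual.finrank_ker_add_one_of_ne_zero h1
    rw [finrank_extendCode] at hdim
    rw [Submodule.finrank_map_subtype_eq]
    omega
  have hFK : Module.finrank F K = 2 := by
    have h := Module.card_eq_pow_finrank (K := F) (V := K)
    rw [hK, hF] at h
    exact (Nat.pow_right_injective (by omega : 2 ≤ q) h).symm
  obtain ⟨β, x, y, hcoord, hxy, hβN, hx, hy, hspan⟩ :=
    exists_powers_of_rotation_invariant (K := K) hFK D hDdim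
      (fun c hc => (hD _).mpr ⟨hcyc.rotate_mem ((hD c).mp hc).1 1,
        (sum_rotate c).trans ((hD c).mp hc).2⟩)
      (fun c hc => by
        by_contra! h
        exact hfull c h ((hD c).mp hc).2 ((hD c).mp hc).1)
  have hcoord_eq : ∀ {r s r' s' : F}, algebraMap F K r + s • β = algebraMap F K r' + s' • β →
      r = r' ∧ s = s' := fun {r s r' s'} h =>
    Prod.mk.inj ((hcoord _).unique (y₁ := (r, s)) (y₂ := (r', s')) rfl h)
  have hC : ∀ c, c ∈ extendCode C' ↔ ∃ r s u : F,
      c = Fin.snoc (fun i : Fin N => r * x i + s * y i + u) u := by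
    intro c
    have hsum : ∀ r s u : F, ∑ i : Fin N, (r * x i + s * y i + u) = u := by
      intro r s u
      rw [Finset.sum_add_distrib, Finset.sum_add_distrib, ← Finset.mul_sum, ← Finset.mul_sum,
        ((hD _).mp hx).2, ((hD _).mp hy).2]
      simp [hNF]
    rw [mem_extendCode_iff]
    constructor
    · rintro ⟨d, hd, rfl⟩
      obtain ⟨r, s, h⟩ := hspan (d - (∑ i, d i) • fun _ => 1) ((hD _).mpr
        ⟨C'.sub_mem hd (C'.smul_mem _ hone), by simp [Finset.sum_sub_distrib, hNF]⟩)
      refine ⟨r, s, ∑ i, d i, ?_⟩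
      congr 1
      ext i
      rw [← h i]
      simp
    · rintro ⟨r, s, u, rfl⟩
      refine ⟨_, ?_, congrArg _ (hsum r s u)⟩
      exact C'.add_mem (C'.add_mem (C'.smul_mem r ((hD _).mp hx).1)
        (C'.smul_mem s ((hD _).mp hy).1)) 
        (by simpa [Pi.smul_def] using C'.smul_mem u hone)
  have hβ0 : β ≠ 0 := by
    rintro rfl
    rw [zero_pow (by omega)] at hβN
    exact zero_ne_one hβN
  have hord : orderOf β = N := by
    refine le_antisymm (orderOf_le_of_pow_eq_one (by omega) hβN) ?_
    by_contra! hlt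
    have hpos : 0 < orderOf β := orderOf_pos_iff.mpr (isOfFinOrder_iff_pow_eq_one.mpr
      ⟨N, by omega, hβN⟩)
    obtain ⟨c, hc, h0, h1⟩ := hsep (Fin.castSucc ⟨orderOf β, hlt⟩) (Fin.castSucc 0)
      (fun h => hpos.ne' (congrArg Fin.val h))
    obtain ⟨r, s, u, rfl⟩ := (hC _).mp hc
    obtain ⟨hx0, hy0⟩ := hcoord_eq (r := x (orderOf β)) (s := y (orderOf β)) (r' := x 0)
      (s' := y 0) (by rw [hxy, hxy, pow_orderOf_eq_one, pow_zero])
    simp only [Fin.snoc_castSucc] at h0 h1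
    rw [hx0, hy0] at h1
    exact h1 h0
  have hprim : IsPrimitiveRoot β N := hord ▸ IsPrimitiveRoot.orderOf β
  have hrange : (Set.range fun i : Fin N => β ^ (i : ℕ)) = {z : K | z ^ N = 1} := by
    ext z
    constructor
    · rintro ⟨i, rfl⟩
      rw [Set.mem_ofPred_eq, ← pow_mul, mul_comm, pow_mul, hβN, one_pow]
    · intro hz
      obtain ⟨i, hi, rfl⟩ := hprim.eq_pow_of_pow_eq_one hz
      exact ⟨⟨i, hi⟩, rfl⟩
  let g : Fin (N + 1) → K := Fin.snoc (fun i : Fin N => β ^ (i : ℕ)) 0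
  have hg : Set.range g = {z : K | z ^ N = 1} ∪ {0} := by
    rw [← hrange]
    ext z
    simp [g, eq_comm]
  have hginj : Function.Injective g := by
    rw [Fin.snoc_injective_iff]
    refine ⟨fun i j h => Fin.ext (hprim.pow_inj i.2 j.2 h), ?_⟩
    rintro ⟨i, hi⟩
    exact pow_ne_zero _ hβ0 hi
  refine ⟨?_, β⁻¹, β, fun i => x i, fun i => y i, ?_, hcoord, ?_, ?_, ?_, ?_, ?_⟩
  · rw [← hord, ← hK]
    exact orderOf_dvd_of_pow_eq_one (FiniteField.pow_card_sub_one_eq_one β hβ0)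
  · rw [← hord]
    exact orderOf_eq_orderOf_iff.mpr fun n => by rw [inv_pow, inv_eq_one]
  · intro i
    rw [inv_inv, hxy]
  · ext c
    rw [hC, Submodule.mem_span_triple]
    refine exists_congr fun r => exists_congr fun s => exists_congr fun u => ?_
    rw [eq_comm]
    refine Eq.congr_left ?_
    ext i
    refine Fin.lastCases ?_ (fun j => ?_) i <;> simp
  · rw [inv_inv, hrange]
  · rw [← hg, ← hlen, ← Set.image_univ, Set.ncard_image_of_injective _ hginj, Set.ncard_univ,
      Nat.card_eq_fintype_card, Fintype.card_fin]
  · intro a b hb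
    obtain ⟨⟨a₁, a₂⟩, ha, -⟩ := hcoord a
    obtain ⟨⟨b₁, b₂⟩, hb', -⟩ := hcoord b
    simp only at ha hb'
    let u : F := -(b₂ * a₁ - b₁ * a₂)
    let w : Fin (N + 1) → F := Fin.snoc (fun i : Fin N => b₂ * x i + -b₁ * y i + u) u
    have hw : w ∈ extendCode C' := (hC w).mpr ⟨_, _, _, rfl⟩
    have hline : ∀ i, (∃ c : F, g i = a + c • b) ↔ w i = 0 := by
      intro i
      refine Fin.lastCases ?_ (fun j => ?_) i
      · rw [exists_eq_add_smul_iff hcoord (z₁ := 0) (z₂ := 0) ha hb' (by simp [g]) hb]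
        simp [w, u]
      · rw [exists_eq_add_smul_iff hcoord (z₁ := x j) (z₂ := y j) ha hb'
          (by simp [g, hxy]) hb]
        simp only [w, u, Fin.snoc_castSucc]
        ring_nf
    have hw0 : w ≠ 0 := by
      intro h
      obtain ⟨hx0, hy0⟩ := hcoord_eq (r := x 0) (s := y 0) (r' := 1) (s' := 0)
        (by rw [hxy]; simp)
      obtain ⟨hx1, hy1⟩ := hcoord_eq (r := x 1) (s := y 1) (r' := 0) (s' := 1)
        (by rw [hxy]; simp)
      have hu : u = 0 := by simpa [w] using congrFun h (Fin.last N)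
      have h0 : b₂ * x 0 + -b₁ * y 0 + u = 0 := by
        have := congrFun h (Fin.castSucc ⟨0, by omega⟩)
        simpa only [w, Fin.snoc_castSucc] using this.trans (Pi.zero_apply _)
      have h1 : b₂ * x 1 + -b₁ * y 1 + u = 0 := by
        have := congrFun h (Fin.castSucc ⟨1, by omega⟩)
        simpa only [w, Fin.snoc_castSucc] using this.trans (Pi.zero_apply _)
      rw [hx0, hy0, hu] at h0
      rw [hx1, hy1, hu] at h1
      have hb2 : b₂ = 0 := by linear_combination h0
      have hb1 : b₁ = 0 := by linear_combination -h1
      exact hb (by rw [hb', hb1, hb2]; simp)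
    have hcount : (({z : K | z ^ N = 1} ∪ {0}) ∩ {z : K | ∃ c : F, z = a + c • b}).ncard =
        Finset.card {i | w i = 0} := by
      rw [← hg, ← Set.ncard_coe_finset, ← Set.ncard_image_of_injective _ hginj]
      congr 1
      ext z
      constructor
      · rintro ⟨⟨i, rfl⟩, hz⟩
        exact ⟨i, by simpa using (hline i).mp hz, rfl⟩
      · rintro ⟨i, hi, rfl⟩
        exact ⟨⟨i, rfl⟩, (hline i).mpr (by simpa using hi)⟩
    rw [hcount]
    by_cases h : ∃ i, w i = 0
    · obtain ⟨i, hi⟩ := h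
      exact Or.inr (hzeros w hw hw0 i hi)
    · left
      push Not at h
      simpa [Finset.filter_eq_empty_iff] using h
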